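/- (Theorem 3, accuracy of the generalized push algorithm, stated via its loop invariant) Let δ > 0, let L ≥ 0, let s be a source node, and let π_s^L(u) = S_L(s, u) denote the L-hop supervised PPR of u with respect to s. Suppose π̂ : V → ℝ and residue functions r^{(k)} : V → ℝ for 0 ≤ k ≤ L satisfy, for every node u: π̂(u) ≤ π_s^L(u) ≤ π̂(u) + Σ_{k=0}^{L} Σ_{v ∈ V} r^{(k)}(v) · h_u^k(v), and 0 ≤ r^{(k)}(v) ≤ δ · d(v) for all 0 ≤ k ≤ L and all v ∈ V (as holds at termination of the generalized push algorithm). Then for every node u: |π̂(u) − π_s^L(u)| / d(u) ≤ (L + 1) · δ. -/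

import Mathlib

/-- `h_u^k(v) = α_k · [v = u] + Σ_{l=1}^{∞} α_{k+l} · (∏_{j=k}^{k+l-1} (1 − α_j)) · P^l(v, u)`. -/
noncomputable def hFun {V : Type*} [Fintype V] [DecidableEq V]
    (P : Matrix V V ℝ) (α : ℕ → ℝ) (u : V) (k : ℕ) (v : V) : ℝ :=
  α k * (if v = u then 1 else 0) +
    ∑' l : ℕ, α (k + (l + 1)) * (∏ j ∈ Finset.range (l + 1), (1 - α (k + j))) *
      (P ^ (l + 1)) v u

/-- The L-hop truncated supervised PPR proximity matrix
`S_L = α_0·I + Σ_{l=1}^{L} α_l · (∏_{k=0}^{l-1} (1 − α_k)) · P^l`. -/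
noncomputable def supPPRTrunc {V : Type*} [Fintype V] [DecidableEq V]
    (P : Matrix V V ℝ) (α : ℕ → ℝ) (L : ℕ) : Matrix V V ℝ :=
  Matrix.of fun s u =>
    α 0 * (if s = u then 1 else 0) +
      ∑ l ∈ Finset.range L,
        α (l + 1) * (∏ k ∈ Finset.range (l + 1), (1 - α k)) * (P ^ (l + 1)) s u

theorem aux_coeff (α : ℕ → ℝ) (k n : ℕ) :
    α k + ∑ l ∈ Finset.range n,
      α (k + (l + 1)) * (∏ j ∈ Finset.range (l + 1), (1 - α (k + j)))
      = 1 - ∏ j ∈ Finset.range (n + 1), (1 - α (k + j)) := by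
  induction n with
  | zero => simp
  | succ n ih =>
    rw [Finset.sum_range_succ, ← add_assoc, ih, Finset.prod_range_succ _ (n + 1)]
    ring

theorem aux_stat {V : Type*} [Fintype V] [DecidableEq V] (P : Matrix V V ℝ) (d : V → ℝ)
    (h : ∀ u, ∑ v, d v * P v u = d u) (l : ℕ) : ∀ u, ∑ v, d v * (P ^ l) v u = d u := by
  induction l with
  | zero => intro u; simp [Matrix.one_apply]
  | succ l ih =>
    intro u
    simp only [pow_succ, Matrix.mul_apply, Finset.mul_sum]
    rw [Finset.sum_comm]
    simp only [← mul_assoc, ← Finset.sum_mul, ih, h]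

theorem aux_nonneg {V : Type*} [Fintype V] [DecidableEq V] (P : Matrix V V ℝ)
    (h : ∀ u v, 0 ≤ P u v) (l : ℕ) : ∀ u v, 0 ≤ (P ^ l) u v := by
  induction l with
  | zero => intro u v; simp only [pow_zero, Matrix.one_apply]; split_ifs <;> norm_num
  | succ l ih =>
    intro u v
    simp only [pow_succ, Matrix.mul_apply]
    exact Finset.sum_nonneg fun i _ => mul_nonneg (ih _ _) (h _ _)

theorem aux_h {V : Type*} [Fintype V] [DecidableEq V] (P : Matrix V V ℝ) (d : V → ℝ)
    (hd : ∀ v, 1 ≤ d v) (hP : ∀ u v, 0 ≤ P u v)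
    (hs : ∀ u, ∑ v, d v * P v u = d u) (α : ℕ → ℝ) (h0 : ∀ k, 0 ≤ α k) (h1 : ∀ k, α k ≤ 1)
    (u : V) (k : ℕ) :
    (∀ v, 0 ≤ hFun P α u k v) ∧ ∑ v, d v * hFun P α u k v ≤ d u := by
  have hdp : ∀ v, 0 ≤ d v := fun v => zero_le_one.trans (hd v)
  set c : ℕ → ℝ := fun l =>
    α (k + (l + 1)) * (∏ j ∈ Finset.range (l + 1), (1 - α (k + j))) with hc
  have hprod : ∀ n, 0 ≤ ∏ j ∈ Finset.range n, (1 - α (k + j)) := fun n =>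
    Finset.prod_nonneg fun j _ => sub_nonneg.2 (h1 _)
  have hc0 : ∀ l, 0 ≤ c l := fun l => mul_nonneg (h0 _) (hprod _)
  have hpart : ∀ n, ∑ l ∈ Finset.range n, c l ≤ 1 - α k := fun n => by
    have := aux_coeff α k n
    have := hprod (n + 1)
    simp only [hc]
    linarith
  have hcs : Summable c := summable_of_sum_range_le hc0 hpart
  have hct : ∑' l, c l ≤ 1 - α k := Real.tsum_le_of_sum_range_le hc0 hpart
  have hPn := aux_nonneg P hP
  have hbd : ∀ l v, (P ^ l) v u ≤ d u := fun l v => by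
    rw [← aux_stat P d hs l u]
    refine le_trans ?_ (Finset.single_le_sum (f := fun v => d v * (P ^ l) v u)
      (fun i _ => mul_nonneg (hdp i) (hPn l i u)) (Finset.mem_univ v))
    exact le_mul_of_one_le_left (hPn l v u) (hd v)
  have hsum : ∀ v, Summable fun l => c l * (P ^ (l + 1)) v u := fun v =>
    Summable.of_nonneg_of_le (fun l => mul_nonneg (hc0 l) (hPn _ _ _))
      (fun l => mul_le_mul_of_nonneg_left (hbd _ v) (hc0 l)) (hcs.mul_right (d u))
  have hh : ∀ v, hFun P α u k v = α k * (if v = u then 1 else 0) +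
      ∑' l, c l * (P ^ (l + 1)) v u := fun v => rfl
  refine ⟨fun v => ?_, ?_⟩
  · rw [hh]
    refine add_nonneg (mul_nonneg (h0 k) (by split_ifs <;> norm_num))
      (tsum_nonneg fun l => mul_nonneg (hc0 l) (hPn _ _ _))
  · simp only [hh, mul_add, Finset.sum_add_distrib, ← tsum_mul_left]
    rw [← Summable.tsum_finsetSum (fun v _ => (hsum v).mul_left (d v))]
    have e : ∀ l, ∑ v, d v * (c l * (P ^ (l + 1)) v u) = c l * d u := fun l => by
      rw [← aux_stat P d hs (l + 1) u, Finset.mul_sum]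
      exact Finset.sum_congr rfl fun v _ => by ring
    simp only [e, tsum_mul_right]
    have e2 : ∑ v, d v * (α k * (if v = u then 1 else 0)) = d u * α k := by simp
    rw [e2]
    nlinarith [mul_le_mul_of_nonneg_right hct (hdp u)]

/-- Theorem 3, accuracy of the generalized push algorithm, stated via its
loop invariant: if `π̂` and the residues `r^{(k)}` (for `0 ≤ k ≤ L`) satisfy, for every
node `u`, `π̂(u) ≤ π_s^L(u) ≤ π̂(u) + Σ_{k=0}^{L} Σ_{v} r^{(k)}(v)·h_u^k(v)` with
`0 ≤ r^{(k)}(v) ≤ δ·d(v)`, then `|π̂(u) − π_s^L(u)| / d(u) ≤ (L + 1)·δ` for every node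
`u`, where `π_s^L(u) = S_L(s, u)`. -/
theorem stmt_13 {V : Type*} [Fintype V] [DecidableEq V] (G : SimpleGraph V)
    [DecidableRel G.Adj] (hd : ∀ v, 0 < G.degree v)
    (P : Matrix V V ℝ)
    (hP : ∀ u v, P u v = if G.Adj u v then (1 : ℝ) / (G.degree u : ℝ) else 0)
    (α : ℕ → ℝ) (αmin : ℝ) (hαmin_pos : 0 < αmin) (hαmin_le : αmin ≤ 1)
    (hα : ∀ k : ℕ, αmin ≤ α k ∧ α k ≤ 1)
    (δ : ℝ) (hδ : 0 < δ) (L : ℕ) (s : V)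
    (πhat : V → ℝ) (r : ℕ → V → ℝ)
    (hlow : ∀ u, πhat u ≤ supPPRTrunc P α L s u)
    (hup : ∀ u, supPPRTrunc P α L s u ≤
        πhat u + ∑ k ∈ Finset.range (L + 1), ∑ v, r k v * hFun P α u k v)
    (hr : ∀ k, k ≤ L → ∀ v, 0 ≤ r k v ∧ r k v ≤ δ * (G.degree v : ℝ)) :
    ∀ u, |πhat u - supPPRTrunc P α L s u| / (G.degree u : ℝ) ≤ ((L : ℝ) + 1) * δ := by
  have hd1 : ∀ v, (1 : ℝ) ≤ (G.degree v : ℝ) := fun v => by exact_mod_cast hd v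
  have hPn : ∀ u v, 0 ≤ P u v := fun u v => by
    rw [hP]; split_ifs <;> positivity
  have hs : ∀ u, ∑ v, (G.degree v : ℝ) * P v u = (G.degree u : ℝ) := fun u => by
    have e : ∀ v, (G.degree v : ℝ) * P v u = if G.Adj u v then 1 else 0 := fun v => by
      have h0 : (G.degree v : ℝ) ≠ 0 := by linarith [hd1 v]
      rw [hP]
      by_cases h : G.Adj u v
      · rw [if_pos h, if_pos h.symm]
        field_simp
      · rw [if_neg h, if_neg fun h2 => h h2.symm, mul_zero]
    simp only [e, Finset.sum_boole]
    rw [← G.card_neighborFinset_eq_degree, G.neighborFinset_eq_filter]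
  intro u
  have key := fun k => aux_h P (fun v => (G.degree v : ℝ)) hd1 hPn hs α
    (fun k => hαmin_pos.le.trans (hα k).1) (fun k => (hα k).2) u k
  have hb : ∑ k ∈ Finset.range (L + 1), ∑ v, r k v * hFun P α u k v
      ≤ ∑ k ∈ Finset.range (L + 1), δ * (G.degree u : ℝ) := by
    refine Finset.sum_le_sum fun k hk => ?_
    have hk' : k ≤ L := Nat.lt_succ_iff.1 (Finset.mem_range.1 hk)
    calc ∑ v, r k v * hFun P α u k v
        ≤ ∑ v, δ * ((G.degree v : ℝ) * hFun P α u k v) :=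
          Finset.sum_le_sum fun v _ => by
            rw [← mul_assoc]
            exact mul_le_mul_of_nonneg_right (hr k hk' v).2 ((key k).1 v)
      _ = δ * ∑ v, (G.degree v : ℝ) * hFun P α u k v := by rw [Finset.mul_sum]
      _ ≤ _ := mul_le_mul_of_nonneg_left (key k).2 hδ.le
  rw [Finset.sum_const, Finset.card_range, nsmul_eq_mul] at hb
  push_cast at hb
  rw [div_le_iff₀ (by linarith [hd1 u]), abs_sub_comm, abs_of_nonneg (sub_nonneg.2 (hlow u))]
  linarith [hup u]
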